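/- Let M = (S, A, T, R, γ) be a finite MDP and φ : S → ℝ a potential function. Define the shaped reward R' : S → A → S → ℝ by R' s a s' = R s a s' + γ * φ s' − φ s, and let M' = (S, A, T, R', γ) be the shaped MDP. If Q : S → A → ℝ satisfies the Bellman optimality equation for M, then Q' defined by Q' s a = Q s a − φ s satisfies the Bellman optimality equation for M'. Moreover, for every s ∈ S the sets of maximizing actions coincide: { a ∈ A : Q s a = max_{a' ∈ A} Q s a' } = { a ∈ A : Q' s a = max_{a' ∈ A} Q' s a' }; in particular, any policy greedy with respect to Q is greedy with respect to Q'. -/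

import Mathlib

/-- Subtracting a constant commutes with taking a finite nonempty maximum. -/
theorem Finset.sup'_sub_const {ι : Type*} {s : Finset ι} (hs : s.Nonempty) (f : ι → ℝ) (c : ℝ) :
    s.sup' hs (fun i => f i - c) = s.sup' hs f - c := by
  apply le_antisymm
  · exact Finset.sup'_le _ _ fun i hi => sub_le_sub_right (Finset.le_sup' f hi) c
  · rw [sub_le_iff_le_add]
    exact Finset.sup'_le _ _ fun i hi =>
      sub_le_iff_le_add.mp (Finset.le_sup' (fun i => f i - c) hi)

/-- Potential-based reward shaping on a finite MDP: if `Q` satisfies the Bellman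
optimality equation for `M = (S, A, T, R, γ)` and `φ : S → ℝ` is a potential
function, then `Q' s a = Q s a − φ s` satisfies the Bellman optimality equation for
the shaped MDP `M' = (S, A, T, R', γ)` with `R' s a s' = R s a s' + γ * φ s' − φ s`;
moreover, at every state the sets of maximizing actions of `Q` and `Q'` coincide
(so any policy greedy with respect to `Q` is greedy with respect to `Q'`). -/
theorem potential_shaping_preserves_optimality
    {S A : Type*} [Fintype S] [Nonempty S] [Fintype A] [Nonempty A]
    (T : S → A → S → ℝ) (R : S → A → S → ℝ) (γ : ℝ)
    (hT_nonneg : ∀ s a s', 0 ≤ T s a s')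
    (hT_sum : ∀ s a, ∑ s', T s a s' = 1)
    (hγ_nonneg : 0 ≤ γ) (hγ_lt : γ < 1)
    (φ : S → ℝ) (Q : S → A → ℝ)
    (hQ : ∀ s a, Q s a = ∑ s', T s a s' *
      (R s a s' + γ * Finset.univ.sup' Finset.univ_nonempty (fun a' => Q s' a'))) :
    (∀ s a, Q s a - φ s = ∑ s', T s a s' *
      ((R s a s' + γ * φ s' - φ s) +
        γ * Finset.univ.sup' Finset.univ_nonempty (fun a' => Q s' a' - φ s'))) ∧
    (∀ s : S,
      {a : A | Q s a = Finset.univ.sup' Finset.univ_nonempty (fun a' => Q s a')} =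
      {a : A | Q s a - φ s =
        Finset.univ.sup' Finset.univ_nonempty (fun a' => Q s a' - φ s)}) := by
  simp only [Finset.sup'_sub_const]
  refine ⟨fun s a => ?_, fun s => by simp⟩
  have hφ : φ s = ∑ s', T s a s' * φ s := by rw [← Finset.sum_mul, hT_sum, one_mul]
  rw [hQ s a]
  conv_lhs => rw [hφ]
  rw [← Finset.sum_sub_distrib]
  exact Finset.sum_congr rfl fun s' _ => by ring
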